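/- arXiv:1805.02563 — 2 statements merged into one kernel-verified Lean document; each statement's English description precedes it below -/
import Mathlib

section
/- Suppose k ≥ 2. Let i, i_1, …, i_k ∈ {1,…,n} with i_1, …, i_k ≠ i. Then for every 1 ≤ ℓ ≤ k+1, Θ_ℓ(e_i^*⊗[e_{i_1}, e_{i_2}, …, e_{i_k}, e_i]) = 0. (That is, every generator of type K2 lies in the kernel of every Θ_ℓ.) -/
open scoped TensorProduct

namespace JC

/-- Words of length `m` in the letters `0,…,N-1`: index words for a basis of `H^{⊗m}`. -/
abbrev Word (N m : ℕ) := Fin m → Fin N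

/-- The `m`-th tensor power `H^{⊗m}` of `H = R^N`, realized as the free module on words. -/
abbrev TP (R : Type) [CommRing R] (N m : ℕ) := Word N m → R

section
variable {R : Type} [CommRing R] {N : ℕ}

/-- The basis element of `H^{⊗m}` corresponding to a word. -/
def eb {m : ℕ} (w : Word N m) : TP R N m := fun u => if u = w then 1 else 0

/-- Prepend the basis vector `e_i` (or the dual basis vector `e_i^*`) to a tensor. -/
def pre {m : ℕ} (i : Fin N) (x : TP R N m) : TP R N (m+1) :=
  fun w => if w 0 = i then x (Fin.tail w) else 0

/-- `[x, e_j] = x ⊗ e_j - e_j ⊗ x` inside the tensor algebra. -/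
def brkt {m : ℕ} (x : TP R N (m+1)) (j : Fin N) : TP R N (m+2) :=
  fun w =>
    (if w (Fin.last (m+1)) = j then x (Fin.init w) else 0)
      - (if w 0 = j then x (Fin.tail w) else 0)

/-- The left-normed bracket `[e_{c 0}, e_{c 1}, …, e_{c (m-1)}] ∈ L_N(m) ⊆ H^{⊗m}`. -/
def lnb : (m : ℕ) → Word N m → TP R N m
  | 0, _ => 0
  | 1, c => eb c
  | m+2, c => brkt (lnb (m+1) (Fin.init c)) (c (Fin.last (m+1)))

/-- The left-normed bracket `[y, e_{c 0}, …, e_{c (m-1)}]` starting from an arbitrary `y ∈ H`. -/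
def lnbY : (m : ℕ) → TP R N 1 → Word N m → TP R N (m+1)
  | 0, y, _ => y
  | m+1, y, c => brkt (lnbY m y (Fin.init c)) (c (Fin.last m))

end

/-- The degree-`m` homogeneous component of the free Lie ring on `H`, inside `H^{⊗m}`
(spanned by the left-normed brackets of basis vectors). -/
def LieComp (R : Type) [CommRing R] (N m : ℕ) : Submodule R (TP R N m) :=
  Submodule.span R (Set.range (lnb (R := R) (N := N) m))

/-- `H^* ⊗ L_N(k+1)` inside `H^* ⊗ H^{⊗(k+1)} = H^{⊗(k+2)}` (the first letter of a word
records the index of a dual basis vector `e_i^*`). -/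
def DLie (R : Type) [CommRing R] (N k : ℕ) : Submodule R (TP R N (k+2)) :=
  Submodule.span R
    { x | ∃ (i : Fin N) (c : Word N (k+1)), x = pre i (lnb (k+1) c) }

section
variable {R : Type} [CommRing R] {N : ℕ}

/-- The contraction `Φ_{1,ℓ+2} : H^* ⊗ H^{⊗(k+1)} → H^{⊗k}` (with 0-based `ℓ`; this is the
paper's `Φ_{1,ℓ+1}` for 1-based `ℓ`): `f ⊗ a_1 ⊗ ⋯ ⊗ a_{k+1} ↦ f(a_{ℓ+1})·a_1 ⊗ ⋯ (omit) ⋯ ⊗ a_{k+1}`. -/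
def Phi (k : ℕ) (ℓ : Fin (k+1)) (x : TP R N (k+2)) : TP R N k :=
  fun u => ∑ i : Fin N, x (Fin.cons i (Fin.insertNth ℓ i u))

end

/-- The submodule of cyclic-permutation relations in `H^{⊗m}`. -/
def cycRel (R : Type) [CommRing R] (N m : ℕ) : Submodule R (TP R N m) :=
  Submodule.span R { x | ∃ w : Word N m, x = eb w - eb (w ∘ finRotate m) }

/-- `C_N(m)`: the quotient of `H^{⊗m}` by the cyclic permutation action. -/
abbrev Cyc (R : Type) [CommRing R] (N m : ℕ) := TP R N m ⧸ cycRel R N m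

/-- The projection `π_m : H^{⊗m} → C_N(m)`. -/
def piC (R : Type) [CommRing R] (N m : ℕ) : TP R N m →ₗ[R] Cyc R N m :=
  (cycRel R N m).mkQ

section
variable {R : Type} [CommRing R] {N : ℕ}

/-- The first `ℓ` letters of a word of length `k`. -/
def splitF {k : ℕ} (ℓ : Fin (k+1)) (u : Word N k) : Word N (ℓ:ℕ) :=
  fun t => u ⟨(t:ℕ), by have h1 := t.isLt; have h2 := ℓ.isLt; omega⟩

/-- The last `k-ℓ` letters of a word of length `k`. -/
def splitB {k : ℕ} (ℓ : Fin (k+1)) (u : Word N k) : Word N (k - (ℓ:ℕ)) :=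
  fun t => u ⟨(ℓ:ℕ) + (t:ℕ), by have h1 := t.isLt; omega⟩

end

/-- `Θ_{ℓ+1} = ϖ_{ℓ+1} ∘ Φ_{1,ℓ+2} : H^* ⊗ L_N(k+1) → C_N(ℓ) ⊗ C_N(k-ℓ)` (0-based `ℓ`,
so this is the paper's `Θ_ℓ` for 1-based `ℓ ∈ {1,…,k+1}`). -/
noncomputable def Theta (R : Type) [CommRing R] (N k : ℕ) (ℓ : Fin (k+1))
    (x : TP R N (k+2)) : (Cyc R N (ℓ:ℕ)) ⊗[R] (Cyc R N (k - (ℓ:ℕ))) :=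
  ∑ u : Word N k,
    (Phi k ℓ x u) •
      ((piC R N (ℓ:ℕ)) (eb (splitF ℓ u)) ⊗ₜ[R] (piC R N (k - (ℓ:ℕ))) (eb (splitB ℓ u)))

section
variable {N : ℕ}

/-- The word realizing `e_{←S} ⊗ e_{→S^c}`: the letters of `c` at the positions of `S` in
decreasing order of position, followed by the letters at the positions of the complement of
`S` in increasing order of position. -/
def swWord {k : ℕ} (c : Word N k) (s : Finset (Fin k)) : Word N k := fun j =>
  if h : (j:ℕ) < s.card then
    c ((s.orderIsoOfFin rfl) ⟨s.card - 1 - (j:ℕ), by omega⟩).1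
  else
    c ((sᶜ.orderIsoOfFin rfl) ⟨(j:ℕ) - s.card, by
      have h1 : sᶜ.card = k - s.card := by simp [Finset.card_compl]
      have h2 := j.isLt
      omega⟩).1

end

section
variable {R : Type} [CommRing R] {N : ℕ}

/-- Insert the vector `y ∈ H` at position `p` of a degree-`k` tensor. -/
def insT {k : ℕ} (p : Fin (k+1)) (y : TP R N 1) (x : TP R N k) : TP R N (k+1) :=
  fun w => y (fun _ => w p) * x (p.removeNth w)

end

/-- Generators of type `K_1`. -/
def K1set (R : Type) [CommRing R] (N k : ℕ) : Set (TP R N (k+2)) :=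
  { x | ∃ (i : Fin N) (d : Word N (k+1)), (∀ t, d t ≠ i) ∧ x = pre i (lnb (k+1) d) }

/-- Generators of type `K_2`. -/
def K2set (R : Type) [CommRing R] (N k : ℕ) : Set (TP R N (k+2)) :=
  { x | ∃ (i : Fin N) (c : Word N k), (∀ t, c t ≠ i) ∧
      x = pre i (lnb (k+1) (Fin.snoc c i)) }

/-- Generators of type `K_3`. -/
def K3set (R : Type) [CommRing R] (N k : ℕ) : Set (TP R N (k+2)) :=
  { x | ∃ (i j : Fin N) (c : Word N k), (∀ t, c t ≠ i) ∧ (∀ t, c t ≠ j) ∧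
      x = pre i (lnb (k+1) (Fin.cons i c))
        - pre j (lnb (k+1) (Fin.cons j (c ∘ (finRotate k).symm))) }

/-- Generators of type `K_4`. -/
def K4set (R : Type) [CommRing R] (N k : ℕ) : Set (TP R N (k+2)) :=
  { x | ∃ (i m' : Fin N) (d : Word N (k+1)), (∃ j, d j = i) ∧ (∀ t, d t ≠ m') ∧
      x = pre i (lnb (k+1) d)
        - ∑ j : Fin (k+1),
            (if d j = i then (1:R) else 0) • pre m' (lnb (k+1) (Function.update d j m')) }

end JC

namespace JC

/-- A left-normed bracket in letters different from `i` is supported on words avoiding `i`. -/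
theorem lnb_apply_eq_zero {R : Type} [CommRing R] {N : ℕ} (i : Fin N) :
    ∀ (m : ℕ) (c w : Word N m), (∀ t, c t ≠ i) → (∃ t, w t = i) → lnb (R := R) m c w = 0
  | 0, _, _, _, _ => rfl
  | 1, c, w, hc, ⟨t, ht⟩ => by
    have hwc : w ≠ c := fun h => hc t (h ▸ ht)
    simp [lnb, eb, hwc]
  | m + 2, c, w, hc, ⟨t, ht⟩ => by
    have ih := fun v => lnb_apply_eq_zero (R := R) i (m + 1) (Fin.init c) v (fun t => hc _)
    have h1 : (if w (Fin.last (m + 1)) = c (Fin.last (m + 1))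
        then lnb (R := R) (m + 1) (Fin.init c) (Fin.init w) else 0) = 0 := by
      split_ifs with h
      · refine ih _ ?_
        induction t using Fin.lastCases with
        | last => exact absurd (h ▸ ht) (hc _)
        | cast s => exact ⟨s, ht⟩
      · rfl
    have h2 : (if w 0 = c (Fin.last (m + 1))
        then lnb (R := R) (m + 1) (Fin.init c) (Fin.tail w) else 0) = 0 := by
      split_ifs with h
      · refine ih _ ?_
        induction t using Fin.cases with
        | zero => exact absurd (h ▸ ht) (hc _)
        | succ s => exact ⟨s, ht⟩
      · rfl
    simp only [lnb, brkt, h1, h2, sub_zero]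

theorem sum_smul_eb {R : Type} [CommRing R] {N m : ℕ} (x : TP R N m) :
    ∑ u, x u • eb u = x := by
  funext w
  simp [eb, Finset.sum_apply]

theorem cons_comp_finRotate {N m : ℕ} (j : Fin N) (v : Word N m) :
    (Fin.cons j v : Word N (m + 1)) ∘ finRotate (m + 1) = Fin.snoc v j := by
  funext t
  induction t using Fin.lastCases with
  | last => simp
  | cast s => simp

theorem brkt_eq_sum {R : Type} [CommRing R] {N m : ℕ} (y : TP R N (m + 1)) (j : Fin N) :
    brkt y j = ∑ v, y v • (eb (Fin.snoc v j) - eb (Fin.cons j v) : TP R N (m + 2)) := by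
  funext w
  have h1 (v : Word N (m + 1)) : w = (Fin.snoc v j : Word N (m + 2)) ↔
      Fin.init w = v ∧ w (Fin.last (m + 1)) = j := by
    constructor
    · rintro rfl
      simp
    · rintro ⟨rfl, rfl⟩
      simp
  have h2 (v : Word N (m + 1)) : w = (Fin.cons j v : Word N (m + 2)) ↔
      Fin.tail w = v ∧ w 0 = j := by
    constructor
    · rintro rfl
      simp
    · rintro ⟨rfl, rfl⟩
      simp
  simp [brkt, eb, Finset.sum_apply, h1, h2, mul_sub, ite_and]

/-- Brackets vanish in the cyclic quotient. -/
theorem piC_brkt {R : Type} [CommRing R] {N m : ℕ} (y : TP R N (m + 1)) (j : Fin N) :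
    piC R N (m + 2) (brkt y j) = 0 := by
  rw [brkt_eq_sum, map_sum]
  refine Finset.sum_eq_zero fun v _ => ?_
  rw [map_smul, ← neg_sub, map_neg]
  have : piC R N (m + 2) (eb (Fin.cons j v) - eb (Fin.snoc v j)) = 0 :=
    (Submodule.Quotient.mk_eq_zero _).2
      (Submodule.subset_span ⟨Fin.cons j v, by rw [cons_comp_finRotate]⟩)
  rw [this, neg_zero, smul_zero]

theorem piC_lnb {R : Type} [CommRing R] {N m : ℕ} (hm : 2 ≤ m) (c : Word N m) :
    piC R N m (lnb m c) = 0 := by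
  obtain ⟨m, rfl⟩ := Nat.exists_eq_add_of_le' hm
  exact piC_brkt _ _

theorem sum_lnb_smul_piC_eb {R : Type} [CommRing R] {N m : ℕ} (hm : 2 ≤ m) (c : Word N m) :
    ∑ u, lnb (R := R) m c u • piC R N m (eb u) = 0 := by
  simp_rw [← map_smul, ← map_sum, sum_smul_eb, piC_lnb hm]

theorem Phi_pre_apply {R : Type} [CommRing R] {N k : ℕ} (i : Fin N) (x : TP R N (k + 1))
    (ℓ : Fin (k + 1)) (u : Word N k) :
    Phi k ℓ (pre i x) u = x (Fin.insertNth ℓ i u) := by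
  simp [Phi, pre]

theorem lnb_snoc {R : Type} [CommRing R] {N m : ℕ} (c : Word N (m + 1)) (i : Fin N) :
    lnb (R := R) (m + 2) (Fin.snoc c i) = brkt (lnb (m + 1) c) i := by
  simp [lnb]

theorem Phi_pre_lnb_snoc {R : Type} [CommRing R] {N m : ℕ} (i : Fin N) (c : Word N (m + 1))
    (hc : ∀ t, c t ≠ i) (ℓ : Fin (m + 2)) (u : Word N (m + 1)) :
    Phi (m + 1) ℓ (pre i (lnb (R := R) (m + 2) (Fin.snoc c i))) u =
      (if ℓ = Fin.last (m + 1) then lnb (m + 1) c u else 0)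
        - (if ℓ = 0 then lnb (m + 1) c u else 0) := by
  have hz := fun w => lnb_apply_eq_zero (R := R) i (m + 1) c w hc
  rw [Phi_pre_apply, lnb_snoc, brkt]
  congr 1
  · induction ℓ using Fin.lastCases with
    | last => simp
    | cast s =>
      rw [if_neg (Fin.castSucc_lt_last s).ne, hz, ite_self]
      exact ⟨s, by simp [Fin.init]⟩
  · induction ℓ using Fin.cases with
    | zero => simp
    | succ s =>
      rw [if_neg (Fin.succ_ne_zero s), hz, ite_self]
      exact ⟨s, by simp [Fin.tail]⟩

end JC

open JC in
/-- for `k ≥ 2` and indices `i, i_1, …, i_k` with `i_1, …, i_k ≠ i`,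
the type `K_2` generator `e_i^* ⊗ [e_{i_1}, …, e_{i_k}, e_i]` lies in the kernel of `Θ_ℓ`
for every `1 ≤ ℓ ≤ k+1` (here `ℓ : Fin (k+1)` is 0-based). -/
theorem Theta_of_K2_generator_eq_zero (n k : ℕ) (hk : 2 ≤ k) (i : Fin n) (c : Word n k)
    (hc : ∀ t, c t ≠ i) (ℓ : Fin (k+1)) :
    Theta ℤ n k ℓ (pre i (lnb (k+1) (Fin.snoc c i))) = 0 := by
  obtain ⟨m, rfl⟩ := Nat.exists_eq_add_of_le' (one_le_two.trans hk)
  simp only [Theta, Phi_pre_lnb_snoc i c hc, sub_smul, Finset.sum_sub_distrib]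
  have hlast : ∑ u : Word n (m + 1), (if ℓ = Fin.last (m + 1) then lnb (R := ℤ) (m + 1) c u else 0)
      • ((piC ℤ n ℓ) (eb (splitF ℓ u)) ⊗ₜ[ℤ] (piC ℤ n (m + 1 - ℓ)) (eb (splitB ℓ u))) = 0 := by
    split_ifs with h
    · subst h
      have hB (u : Word n (m + 1)) :
          splitB (Fin.last (m + 1)) u = splitB (Fin.last (m + 1)) c :=
        funext fun t => absurd t.isLt (by simp)
      simp_rw [hB, TensorProduct.smul_tmul', ← TensorProduct.sum_tmul]
      exact (congrArg (· ⊗ₜ[ℤ] _) (sum_lnb_smul_piC_eb hk c)).trans (TensorProduct.zero_tmul _ _)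
    · simp
  have hzero : ∑ u : Word n (m + 1), (if ℓ = 0 then lnb (R := ℤ) (m + 1) c u else 0)
      • ((piC ℤ n ℓ) (eb (splitF ℓ u)) ⊗ₜ[ℤ] (piC ℤ n (m + 1 - ℓ)) (eb (splitB ℓ u))) = 0 := by
    split_ifs with h
    · subst h
      have hF (u : Word n (m + 1)) : splitF 0 u = splitF 0 c :=
        funext fun t => absurd t.isLt (by simp)
      have hB (u : Word n (m + 1)) : splitB 0 u = u :=
        funext fun t => congrArg u (Fin.ext (Nat.zero_add _))
      simp_rw [hF, ← TensorProduct.tmul_smul, ← TensorProduct.tmul_sum]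
      refine (congrArg (_ ⊗ₜ[ℤ] ·) ?_).trans (TensorProduct.tmul_zero _ _)
      refine Eq.trans (Finset.sum_congr rfl fun u _ => ?_) (sum_lnb_smul_piC_eb hk c)
      exact congrArg (fun v => lnb (R := ℤ) (m + 1) c u • piC ℤ n (m + 1) (eb v)) (hB u)
    · simp
  rw [hlast, hzero, sub_zero]
end

section
/- Suppose k ≥ 2. Let i, j, i_1, …, i_k ∈ {1,…,n} with i, j ∉ {i_1,…,i_k} (possibly i = j). Then for every 1 ≤ ℓ ≤ k+1, Θ_ℓ( e_i^*⊗[e_i, e_{i_1}, …, e_{i_k}] − e_j^*⊗[e_j, e_{i_k}, e_{i_1}, …, e_{i_{k−1}}] ) = 0. (That is, every generator of type K3 lies in the kernel of every Θ_ℓ.) -/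
open scoped TensorProduct

namespace JC

section
variable {M : Type*} [AddCommGroup M] {α : Type*}

/-- The signed sum of `f p q` over all ways to split a list into a subsequence `p`, read in
reverse order, and the complementary subsequence `q`; the sign is `(-1) ^ p.length`. -/
def unshuffleSum : List α → (List α → List α → M) → M
  | [], f => f [] []
  | a :: c, f =>
    unshuffleSum c (fun p q => f p (a :: q)) - unshuffleSum c (fun p q => f (p ++ [a]) q)

theorem unshuffleSum_concat (a : α) (c : List α) (f : List α → List α → M) :
    unshuffleSum (c ++ [a]) f =
      unshuffleSum c (fun p q => f p (q ++ [a])) - unshuffleSum c (fun p q => f (a :: p) q) := by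
  induction c generalizing f with
  | nil => simp [unshuffleSum]
  | cons b c ih =>
    simp only [List.cons_append, unshuffleSum, ih]
    abel

theorem unshuffleSum_congr {c : List α} {f g : List α → List α → M}
    (h : ∀ p q, (p ++ q).Perm c → f p q = g p q) : unshuffleSum c f = unshuffleSum c g := by
  induction c generalizing f g with
  | nil => exact h [] [] (List.Perm.refl _)
  | cons a c ih =>
    simp only [unshuffleSum]
    congr 1
    · exact ih fun p q hpq => h _ _ (List.perm_middle.trans (hpq.cons a))
    · refine ih fun p q hpq => h _ _ ?_
      rw [List.append_assoc]
      exact List.perm_middle.trans (hpq.cons a)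

theorem unshuffleSum_cons_eq_concat {f : List α → List α → M}
    (hl : ∀ a p q, f (a :: p) q = f (p ++ [a]) q) (hr : ∀ a p q, f p (a :: q) = f p (q ++ [a]))
    (a : α) (c : List α) : unshuffleSum (a :: c) f = unshuffleSum (c ++ [a]) f := by
  rw [unshuffleSum_concat, unshuffleSum]
  simp only [hl, hr]

theorem unshuffleSum_smul {R : Type*} [Ring R] [Module R M] (c : List α)
    (f : List α → List α → R) (x : M) :
    unshuffleSum c f • x = unshuffleSum c (fun p q => f p q • x) := by
  induction c generalizing f with
  | nil => rfl
  | cons a c ih => simp only [unshuffleSum, sub_smul, ih]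

theorem unshuffleSum_zero (c : List α) :
    unshuffleSum c (fun _ _ => (0 : M)) = 0 := by
  induction c with
  | nil => rfl
  | cons a c ih => simp only [unshuffleSum, ih, sub_zero]

theorem unshuffleSum_sum {ι : Type*} (s : Finset ι) (c : List α) (f : ι → List α → List α → M) :
    ∑ u ∈ s, unshuffleSum c (f u) = unshuffleSum c (fun p q => ∑ u ∈ s, f u p q) := by
  induction c generalizing f with
  | nil => rfl
  | cons a c ih => simp only [unshuffleSum, Finset.sum_sub_distrib, ih]

end

section
variable {R : Type} [CommRing R] {N : ℕ}

/-- The basis tensor of `H^{⊗m}` spelled by a list, or zero if the list has length other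
than `m`. -/
def listTensor (R : Type) [CommRing R] {N : ℕ} (m : ℕ) (p : List (Fin N)) : TP R N m :=
  fun w => if List.ofFn w = p then 1 else 0

theorem listTensor_ofFn {m : ℕ} (w : Word N m) : listTensor R m (List.ofFn w) = eb w := by
  funext u
  simp [listTensor, eb, List.ofFn_inj]

theorem listTensor_eq_zero {m : ℕ} {p : List (Fin N)} (h : p.length ≠ m) :
    listTensor R m p = 0 := by
  funext w
  refine if_neg ?_
  rintro rfl
  simp at h

theorem piC_listTensor_cons (m : ℕ) (a : Fin N) (p : List (Fin N)) :
    piC R N m (listTensor R m (a :: p)) = piC R N m (listTensor R m (p ++ [a])) := by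
  by_cases h : p.length + 1 = m
  · subst h
    obtain ⟨v, hv⟩ : ∃ v : Word N p.length, p = List.ofFn v := ⟨p.get, (List.ofFn_get p).symm⟩
    have h1 : a :: p = List.ofFn (Fin.cons a v : Word N (p.length + 1)) := by
      rw [List.ofFn_cons, ← hv]
    have h2 : p ++ [a] =
        List.ofFn ((Fin.cons a v : Word N (p.length + 1)) ∘ finRotate (p.length + 1)) := by
      have := Fin.snoc_eq_cons_rotate (α := Fin N) v a
      rw [Function.comp_def, ← this, List.ofFn_succ', List.concat_eq_append]
      simp [← hv]
    rw [h1, h2, listTensor_ofFn, listTensor_ofFn]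
    exact (Submodule.Quotient.eq _).2 (Submodule.subset_span ⟨_, rfl⟩)
  · rw [listTensor_eq_zero (by simpa using h), listTensor_eq_zero (by simpa using h)]

theorem lnb_cons (i : Fin N) {k : ℕ} (c : Word N k) (w : Word N (k + 1)) :
    lnb (R := R) (k + 1) (Fin.cons i c) w =
      unshuffleSum (List.ofFn c) (fun p q => listTensor R (k + 1) (p ++ i :: q) w) := by
  induction k with
  | zero =>
    have h : [i] = List.ofFn (Fin.cons i c : Word N 1) := by simp
    simp only [List.ofFn_zero, unshuffleSum, List.nil_append]
    rw [h, listTensor_ofFn]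
    rfl
  | succ k ih =>
    induction c using Fin.snocCases with
    | _ c a =>
    have hc : List.ofFn (Fin.snoc c a : Word N (k + 1)) = List.ofFn c ++ [a] := by
      rw [List.ofFn_succ', List.concat_eq_append]; simp
    have hL : lnb (R := R) (k + 2) (Fin.cons i (Fin.snoc c a : Word N (k + 1))) =
        brkt (lnb (k + 1) (Fin.cons i c)) a := by
      rw [lnb, Fin.cons_snoc_eq_snoc_cons, Fin.init_snoc, Fin.snoc_last]
    rw [hL, hc, unshuffleSum_concat, brkt]
    congr 1
    · have hw : List.ofFn w = List.ofFn (Fin.init w) ++ [w (Fin.last _)] := by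
        rw [List.ofFn_succ', List.concat_eq_append]; rfl
      rw [ih]
      split_ifs with h
      · congr! 3 with p q
        simp only [listTensor, hw, h, ← List.cons_append, ← List.append_assoc,
          List.append_left_inj]
      · rw [← unshuffleSum_zero (M := R) (List.ofFn c)]
        congr! 3 with p q
        symm
        simp only [listTensor, hw]
        rw [← List.cons_append, ← List.append_assoc, if_neg]
        intro e
        exact h (by simpa using (List.append_inj' e rfl).2)
    · have hw : List.ofFn w = w 0 :: List.ofFn (Fin.tail w) := List.ofFn_succ
      rw [ih]
      split_ifs with h
      · congr! 3 with p q
        simp only [listTensor, hw, h, List.cons_append, List.cons.injEq, true_and]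
      · rw [← unshuffleSum_zero (M := R) (List.ofFn c)]
        congr! 3 with p q
        simp [listTensor, h]

theorem Phi_pre (k : ℕ) (ℓ : Fin (k + 1)) (i : Fin N) (x : TP R N (k + 1)) (u : Word N k) :
    Phi k ℓ (pre i x) u = x (Fin.insertNth ℓ i u) := by
  simp [Phi, pre]

theorem Theta_sub (k : ℕ) (ℓ : Fin (k + 1)) (x y : TP R N (k + 2)) :
    Theta R N k ℓ (x - y) = Theta R N k ℓ x - Theta R N k ℓ y := by
  rw [Theta, Theta, Theta, ← Finset.sum_sub_distrib]
  refine Finset.sum_congr rfl fun u _ => ?_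
  refine Eq.trans ?_ (sub_smul (Phi k ℓ x u) (Phi k ℓ y u)
    (piC R N (ℓ : ℕ) (eb (splitF ℓ u)) ⊗ₜ[R] piC R N (k - (ℓ : ℕ)) (eb (splitB ℓ u))))
  simp [Phi]

theorem ofFn_splitF {k : ℕ} (ℓ : Fin (k + 1)) (u : Word N k) :
    List.ofFn (splitF ℓ u) = (List.ofFn u).take ℓ := by
  apply List.ext_getElem
  · simp; omega
  · intro t h1 h2
    simp [splitF]

theorem ofFn_splitB {k : ℕ} (ℓ : Fin (k + 1)) (u : Word N k) :
    List.ofFn (splitB ℓ u) = (List.ofFn u).drop ℓ := by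
  apply List.ext_getElem
  · simp
  · intro t h1 h2
    simp [splitB]

theorem ofFn_insertNth {k : ℕ} (ℓ : Fin (k + 1)) (i : Fin N) (u : Word N k) :
    List.ofFn (Fin.insertNth ℓ i u : Word N (k + 1)) =
      (List.ofFn u).take ℓ ++ i :: (List.ofFn u).drop ℓ := by
  apply List.ext_getElem
  · simp; omega
  · intro t h1 h2
    have ht : t < k + 1 := by simpa using h1
    have hℓ := ℓ.isLt
    rw [List.getElem_ofFn]
    change Fin.insertNth (α := fun _ => Fin N) ℓ i u ⟨t, ht⟩ = _
    rcases lt_trichotomy t (ℓ : ℕ) with h | h | h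
    · rw [List.getElem_append_left (by simp; omega),
        Fin.insertNth_apply_below (i := ℓ) (j := ⟨t, ht⟩) h]
      simp
      rfl
    · obtain rfl : (⟨t, ht⟩ : Fin (k + 1)) = ℓ := Fin.ext h
      rw [List.getElem_append_right (by simp), Fin.insertNth_apply_same]
      simp [Nat.min_eq_left (Nat.le_of_lt_succ ht)]
    · obtain ⟨d, rfl⟩ := Nat.exists_eq_add_of_lt h
      rw [List.getElem_append_right (by simp; omega),
        Fin.insertNth_apply_above (i := ℓ) (j := ⟨_, ht⟩) h]
      simp [Nat.min_eq_left (Nat.le_of_lt_succ hℓ), Fin.pred, Fin.subNat, Nat.add_assoc]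

/-- The class in `C_N(ℓ) ⊗ C_N(k-ℓ)` of a pair of words spelled by lists. -/
noncomputable def cycPair (R : Type) [CommRing R] {N : ℕ} (k ℓ : ℕ) (p q : List (Fin N)) :
    Cyc R N ℓ ⊗[R] Cyc R N (k - ℓ) :=
  piC R N ℓ (listTensor R ℓ p) ⊗ₜ[R] piC R N (k - ℓ) (listTensor R (k - ℓ) q)

theorem sum_listTensor_smul {k : ℕ} (ℓ : Fin (k + 1)) {i : Fin N} {p q : List (Fin N)}
    (hlen : p.length + q.length = k) (hp : i ∉ p) (hq : i ∉ q) :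
    ∑ u : Word N k, listTensor R (k + 1) (p ++ i :: q) (Fin.insertNth ℓ i u) •
      (piC R N (ℓ : ℕ) (eb (splitF ℓ u)) ⊗ₜ[R] piC R N (k - (ℓ : ℕ)) (eb (splitB ℓ u))) =
    cycPair R k ℓ p q := by
  have key : ∀ u : Word N k, listTensor R (k + 1) (p ++ i :: q) (Fin.insertNth ℓ i u) =
      if p.length = ℓ ∧ List.ofFn u = p ++ q then 1 else 0 := by
    intro u
    rw [listTensor, ofFn_insertNth]
    refine if_congr ⟨fun h => ?_, fun ⟨h, e⟩ => ?_⟩ rfl rfl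
    · have hl : p.length = ℓ := by
        have hg : (p ++ i :: q)[(ℓ : ℕ)]? = some i := by
          rw [← h, List.getElem?_append_right (by simp)]
          simp [Nat.min_eq_left (Nat.le_of_lt_succ ℓ.isLt)]
        by_contra hne
        rcases lt_or_gt_of_ne hne with hlt | hlt
        · obtain ⟨d, hd⟩ := Nat.exists_eq_add_of_lt hlt
          rw [List.getElem?_append_right hlt.le, hd, Nat.add_assoc, Nat.add_sub_cancel_left,
            List.getElem?_cons_succ] at hg
          exact hq (List.mem_of_getElem? hg)
        · rw [List.getElem?_append_left hlt] at hg
          exact hp (List.mem_of_getElem? hg)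
      obtain ⟨h1, h2⟩ := List.append_inj h (by simp; omega)
      refine ⟨hl, ?_⟩
      rw [← h1, ← (List.cons.inj h2).2, List.take_append_drop]
    · rw [e, ← h, List.take_left, List.drop_left]
  simp only [key]
  by_cases hl : p.length = ℓ
  · obtain ⟨v, hv⟩ : ∃ v : Word N k, List.ofFn v = p ++ q := by
      have hlen' : (p ++ q).length = k := by simpa using hlen
      subst hlen'
      exact ⟨(p ++ q).get, List.ofFn_get _⟩
    rw [Finset.sum_eq_single v]
    · rw [if_pos ⟨hl, hv⟩, one_smul, cycPair, ← listTensor_ofFn, ← listTensor_ofFn,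
        ofFn_splitF, ofFn_splitB, hv, ← hl, List.take_left, List.drop_left]
    · intro u _ hu
      rw [if_neg, zero_smul]
      rintro ⟨-, e⟩
      exact hu (List.ofFn_injective (e.trans hv.symm))
    · simp
  · simp [hl, cycPair, listTensor_eq_zero hl]

theorem Theta_pre_lnb_cons {k : ℕ} (ℓ : Fin (k + 1)) {i : Fin N} (c : Word N k)
    (hc : ∀ t, c t ≠ i) :
    Theta R N k ℓ (pre i (lnb (k + 1) (Fin.cons i c))) =
      unshuffleSum (List.ofFn c) (cycPair R k ℓ) := by
  have hi : i ∉ List.ofFn c := by simpa [List.mem_ofFn] using hc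
  have hterm : ∀ u : Word N k, Phi k ℓ (pre i (lnb (R := R) (k + 1) (Fin.cons i c))) u •
      (piC R N (ℓ : ℕ) (eb (splitF ℓ u)) ⊗ₜ[R] piC R N (k - (ℓ : ℕ)) (eb (splitB ℓ u))) =
      unshuffleSum (List.ofFn c) fun p q =>
        listTensor R (k + 1) (p ++ i :: q) (Fin.insertNth ℓ i u) •
        (piC R N (ℓ : ℕ) (eb (splitF ℓ u)) ⊗ₜ[R] piC R N (k - (ℓ : ℕ)) (eb (splitB ℓ u))) := by
    intro u
    rw [Phi_pre, lnb_cons]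
    exact unshuffleSum_smul _ _
      (piC R N (ℓ : ℕ) (eb (splitF ℓ u)) ⊗ₜ[R] piC R N (k - (ℓ : ℕ)) (eb (splitB ℓ u)))
  rw [Theta, Finset.sum_congr rfl fun u _ => hterm u, unshuffleSum_sum]
  refine unshuffleSum_congr fun p q hpq => ?_
  refine sum_listTensor_smul ℓ (by simpa using hpq.length_eq) (fun h => hi ?_) (fun h => hi ?_)
  · exact hpq.subset (List.mem_append_left _ h)
  · exact hpq.subset (List.mem_append_right _ h)

end

end JC

open JC in
/-- for `k ≥ 2` and indices `i, j ∉ {i_1, …, i_k}` (possibly `i = j`),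
the type `K_3` generator
`e_i^* ⊗ [e_i, e_{i_1}, …, e_{i_k}] - e_j^* ⊗ [e_j, e_{i_k}, e_{i_1}, …, e_{i_{k-1}}]`
lies in the kernel of `Θ_ℓ` for every `1 ≤ ℓ ≤ k+1` (here `ℓ : Fin (k+1)` is 0-based). -/
theorem Theta_of_K3_generator_eq_zero (n k : ℕ) (hk : 2 ≤ k) (i j : Fin n)
    (c : Word n k) (hci : ∀ t, c t ≠ i) (hcj : ∀ t, c t ≠ j) (ℓ : Fin (k+1)) :
    Theta ℤ n k ℓ
        ((pre i (lnb (k+1) (Fin.cons i c)) : TP ℤ n (k+2))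
          - pre j (lnb (k+1) (Fin.cons j (c ∘ (finRotate k).symm)))) = 0 := by
  rw [Theta_sub, Theta_pre_lnb_cons ℓ c hci,
    Theta_pre_lnb_cons ℓ (c ∘ (finRotate k).symm) fun t => hcj _, sub_eq_zero]
  obtain ⟨k, rfl⟩ : ∃ m, k = m + 1 := ⟨k - 1, by omega⟩
  have hc : List.ofFn c = List.ofFn (Fin.init c) ++ [c (Fin.last k)] := by
    rw [List.ofFn_succ', List.concat_eq_append]; rfl
  have hrot : List.ofFn (c ∘ (finRotate (k + 1)).symm) =
      c (Fin.last k) :: List.ofFn (Fin.init c) := by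
    rw [← List.ofFn_cons]
    congr 1
    rw [Equiv.comp_symm_eq]
    have := Fin.snoc_eq_cons_rotate (α := Fin n) (Fin.init c) (c (Fin.last k))
    rw [Function.comp_def, ← this, Fin.snoc_init_self]
  rw [hc, hrot]
  refine (unshuffleSum_cons_eq_concat (fun a p q => ?_) (fun a p q => ?_) _ _).symm
  · rw [cycPair, piC_listTensor_cons, cycPair]
  · rw [cycPair, piC_listTensor_cons, cycPair]
end
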